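/- Assume the triple (O, A, a) satisfies conditions (i) and (ii), and assume that for every left a-comodule M the ℂ-linear map (A ⊗ M)^a → M given by w ↦ (ε_A ⊗ id_M)(w) is surjective. Then ι(m)·A = ker(π), i.e. condition (iii) holds. -/

import Mathlib

open TensorProduct

noncomputable section

/-- A left comodule structure, over a `ℂ`-coalgebra `C`, on a `ℂ`-vector space `M`:
the coaction `ρ` is coassociative and counital. -/
def IsLeftComodule (C M : Type) [AddCommGroup C] [Module ℂ C] [Coalgebra ℂ C]
    [AddCommGroup M] [Module ℂ M] (ρ : M →ₗ[ℂ] C ⊗[ℂ] M) : Prop :=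
  ((TensorProduct.assoc ℂ C C M).toLinearMap ∘ₗ
      TensorProduct.map Coalgebra.comul LinearMap.id ∘ₗ ρ =
    TensorProduct.map LinearMap.id ρ ∘ₗ ρ) ∧
  ((TensorProduct.lid ℂ M).toLinearMap ∘ₗ
      TensorProduct.map Coalgebra.counit LinearMap.id ∘ₗ ρ = LinearMap.id)

/-- The right `a`-comodule structure `ρ_A := (id_A ⊗ π) ∘ Δ_A` on a bialgebra `A`. -/
def rhoA (A a : Type) [Ring A] [Bialgebra ℂ A] [AddCommGroup a] [Module ℂ a]
    (π : A →ₗ[ℂ] a) : A →ₗ[ℂ] A ⊗[ℂ] a :=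
  TensorProduct.map LinearMap.id π ∘ₗ Coalgebra.comul

/-- The cotensor product `(A ⊗ M)^a`: the subspace of `w ∈ A ⊗ M` with
`(ρ_A ⊗ id_M)(w) = (id_A ⊗ ρ_M)(w)` in `A ⊗ a ⊗ M`. -/
def cotensor (A a M : Type) [Ring A] [Bialgebra ℂ A]
    [AddCommGroup a] [Module ℂ a] [AddCommGroup M] [Module ℂ M]
    (π : A →ₗ[ℂ] a) (ρM : M →ₗ[ℂ] a ⊗[ℂ] M) : Submodule ℂ (A ⊗[ℂ] M) :=
  LinearMap.ker
    ((TensorProduct.assoc ℂ A a M).toLinearMap ∘ₗ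
        TensorProduct.map (rhoA A a π) LinearMap.id -
      TensorProduct.map LinearMap.id ρM)

/-- The evaluation `ε_A ⊗ id_M : A ⊗ M → M`. -/
def counitEval (A M : Type) [Ring A] [Bialgebra ℂ A] [AddCommGroup M] [Module ℂ M] :
    A ⊗[ℂ] M →ₗ[ℂ] M :=
  (TensorProduct.lid ℂ M).toLinearMap ∘ₗ TensorProduct.map Coalgebra.counit LinearMap.id

section GaloisMap

variable {A N : Type} [Ring A] [AddCommGroup N] [Module ℂ N]

/-- For a bilinear map `act : N × A → N`, the map `n ⊗ y ↦ act n y₁ ⊗ y₂`. -/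
def galoisMap [Bialgebra ℂ A] (act : N →ₗ[ℂ] A →ₗ[ℂ] N) : N ⊗[ℂ] A →ₗ[ℂ] N ⊗[ℂ] A :=
  TensorProduct.lift ((LinearMap.rTensorHom A ∘ₗ act).compl₂ Coalgebra.comul)

theorem galoisMap_tmul [Bialgebra ℂ A] (act : N →ₗ[ℂ] A →ₗ[ℂ] N) (n : N) (y : A) :
    galoisMap act (n ⊗ₜ y) = (act n).rTensor A (Coalgebra.comul (R := ℂ) y) := rfl

theorem galoisMap_galoisMap [Bialgebra ℂ A] (act act' : N →ₗ[ℂ] A →ₗ[ℂ] N) (n : N)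
    (f : A ⊗[ℂ] A →ₗ[ℂ] N) (hf : ∀ x y, act' (act n x) y = f (x ⊗ₜ y))
    (h : ∀ y, f (Coalgebra.comul (R := ℂ) y) = Coalgebra.counit (R := ℂ) y • n) (y : A) :
    galoisMap act' (galoisMap act (n ⊗ₜ y)) = n ⊗ₜ y := by
  have h₁ : galoisMap act' ∘ₗ (act n).rTensor A =
      f.rTensor A ∘ₗ (TensorProduct.assoc ℂ A A A).symm.toLinearMap ∘ₗ
        (Coalgebra.comul (R := ℂ)).lTensor A := by
    ext x z
    have h₂ : (act' (act n x)).rTensor A =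
        f.rTensor A ∘ₗ (TensorProduct.assoc ℂ A A A).symm.toLinearMap ∘ₗ
          TensorProduct.mk ℂ A (A ⊗[ℂ] A) x := by
      ext u v
      simp [hf]
    simpa [galoisMap_tmul] using LinearMap.congr_fun h₂ (Coalgebra.comul (R := ℂ) z)
  have h₃ : f ∘ₗ Coalgebra.comul =
      (LinearMap.toSpanSingleton ℂ N n) ∘ₗ (Coalgebra.counit (R := ℂ) (A := A)) := by
    ext z
    simp [h]
  have h₄ := LinearMap.congr_fun h₁ (Coalgebra.comul (R := ℂ) y)
  simp only [LinearMap.comp_apply, LinearEquiv.coe_coe, Coalgebra.coassoc_symm_apply] at h₄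
  rw [galoisMap_tmul, h₄, ← LinearMap.rTensor_comp_apply, h₃, LinearMap.rTensor_comp_apply,
    Coalgebra.rTensor_counit_comul]
  simp

theorem galoisMap_bijective [HopfAlgebra ℂ A] (act : N →ₗ[ℂ] A →ₗ[ℂ] N)
    (h_one : ∀ n, act n 1 = n) (h_mul : ∀ n y z, act n (y * z) = act (act n y) z) :
    Function.Bijective (galoisMap act) := by
  have hL : galoisMap (act.compl₂ (HopfAlgebra.antipode ℂ)) ∘ₗ galoisMap act =
      LinearMap.id := by
    ext n y
    refine galoisMap_galoisMap _ _ n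
      (act n ∘ₗ LinearMap.mul' ℂ A ∘ₗ (HopfAlgebra.antipode ℂ).lTensor A) ?_ ?_ y
    · simp [h_mul]
    · simp [HopfAlgebra.mul_antipode_lTensor_comul_apply, Algebra.algebraMap_eq_smul_one, h_one]
  have hR : galoisMap act ∘ₗ galoisMap (act.compl₂ (HopfAlgebra.antipode ℂ)) =
      LinearMap.id := by
    ext n y
    refine galoisMap_galoisMap _ _ n
      (act n ∘ₗ LinearMap.mul' ℂ A ∘ₗ (HopfAlgebra.antipode ℂ).rTensor A) ?_ ?_ y
    · simp [h_mul]
    · simp [HopfAlgebra.mul_antipode_rTensor_comul_apply, Algebra.algebraMap_eq_smul_one, h_one]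
  exact ⟨Function.LeftInverse.injective (LinearMap.congr_fun hL),
    Function.RightInverse.surjective (LinearMap.congr_fun hR)⟩

end GaloisMap

section Coaction

variable {A a : Type} [Ring A] [AddCommGroup a] [Module ℂ a]

/-- The right action of `A` on `A ⊗ a` through the comultiplication. -/
def diagonalAct [Bialgebra ℂ A] (ract : a →ₗ[ℂ] A →ₗ[ℂ] a) :
    A ⊗[ℂ] a →ₗ[ℂ] A →ₗ[ℂ] A ⊗[ℂ] a :=
  (TensorProduct.map₂ (LinearMap.mul ℂ A) ract).compl₂ Coalgebra.comul

theorem diagonalAct_tmul [Bialgebra ℂ A] (ract : a →ₗ[ℂ] A →ₗ[ℂ] a) (x : A) (u : a) (y : A) :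
    diagonalAct ract (x ⊗ₜ u) y =
      TensorProduct.map (LinearMap.mul ℂ A x) (ract u) (Coalgebra.comul (R := ℂ) y) := rfl

theorem diagonalAct_one [Bialgebra ℂ A] (ract : a →ₗ[ℂ] A →ₗ[ℂ] a)
    (h_one : ∀ u, ract u 1 = u) (n : A ⊗[ℂ] a) : diagonalAct ract n 1 = n := by
  induction n with
  | zero => simp
  | tmul x u => simp [diagonalAct_tmul, Algebra.TensorProduct.one_def, h_one]
  | add n₁ n₂ h₁ h₂ => simp [h₁, h₂]

theorem map₂_mul_mul [Algebra ℂ A] (ract : a →ₗ[ℂ] A →ₗ[ℂ] a)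
    (h_mul : ∀ u y z, ract u (y * z) = ract (ract u y) z) (n : A ⊗[ℂ] a) (Y Z : A ⊗[ℂ] A) :
    TensorProduct.map₂ (LinearMap.mul ℂ A) ract n (Y * Z) =
      TensorProduct.map₂ (LinearMap.mul ℂ A) ract
        (TensorProduct.map₂ (LinearMap.mul ℂ A) ract n Y) Z := by
  induction n with
  | zero => simp
  | add n₁ n₂ h₁ h₂ => simp [h₁, h₂]
  | tmul x u =>
    induction Y with
    | zero => simp
    | add n₁ n₂ h₁ h₂ => simp only [add_mul, map_add, h₁, h₂, LinearMap.add_apply]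
    | tmul y y' =>
      induction Z with
      | zero => simp
      | add n₁ n₂ h₁ h₂ => simp only [mul_add, map_add, h₁, h₂]
      | tmul z z' => simp [h_mul, mul_assoc]

theorem diagonalAct_mul [Bialgebra ℂ A] (ract : a →ₗ[ℂ] A →ₗ[ℂ] a)
    (h_mul : ∀ u y z, ract u (y * z) = ract (ract u y) z) (n : A ⊗[ℂ] a) (y z : A) :
    diagonalAct ract n (y * z) = diagonalAct ract (diagonalAct ract n y) z := by
  simp only [diagonalAct, LinearMap.compl₂_apply, Bialgebra.comul_mul]
  exact map₂_mul_mul ract h_mul n _ _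

theorem rhoA_mul [Bialgebra ℂ A] (ract : a →ₗ[ℂ] A →ₗ[ℂ] a) (π : A →ₗ[ℂ] a)
    (hπ : ∀ y z, π (y * z) = ract (π y) z) (x y : A) :
    rhoA A a π (x * y) = diagonalAct ract (rhoA A a π x) y := by
  have key : ∀ X Y : A ⊗[ℂ] A, TensorProduct.map LinearMap.id π (X * Y) =
      TensorProduct.map₂ (LinearMap.mul ℂ A) ract (TensorProduct.map LinearMap.id π X) Y := by
    intro X Y
    induction X with
    | zero => simp
    | add n₁ n₂ h₁ h₂ => simp only [add_mul, map_add, h₁, h₂, LinearMap.add_apply]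
    | tmul y y' =>
      induction Y with
      | zero => simp
      | add n₁ n₂ h₁ h₂ => simp only [mul_add, map_add, h₁, h₂]
      | tmul z z' => simp [hπ]
  simp only [rhoA, diagonalAct, LinearMap.compl₂_apply, LinearMap.comp_apply, Bialgebra.comul_mul]
  exact key _ _

theorem galoisMap_rTensor_rhoA [Bialgebra ℂ A] (ract : a →ₗ[ℂ] A →ₗ[ℂ] a) (π : A →ₗ[ℂ] a)
    (hπ : ∀ y z, π (y * z) = ract (π y) z) (s : A ⊗[ℂ] A) :
    galoisMap (diagonalAct ract) ((rhoA A a π).rTensor A s) =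
      (rhoA A a π).rTensor A (galoisMap (LinearMap.mul ℂ A) s) := by
  induction s with
  | zero => simp
  | add n₁ n₂ h₁ h₂ => simp only [map_add, h₁, h₂]
  | tmul p q =>
    have h : diagonalAct ract (rhoA A a π p) = rhoA A a π ∘ₗ LinearMap.mul ℂ A p := by
      ext y
      simp [rhoA_mul ract π hπ]
    rw [LinearMap.rTensor_tmul, galoisMap_tmul, galoisMap_tmul, h, LinearMap.rTensor_comp_apply]

/-- The left coaction `(π ⊗ id) ∘ Δ` on a bialgebra. -/
def leftCoaction [Bialgebra ℂ A] (π : A →ₗ[ℂ] a) : A →ₗ[ℂ] a ⊗[ℂ] A :=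
  π.rTensor A ∘ₗ Coalgebra.comul

theorem galoisMap_rTensor_mk_one [Bialgebra ℂ A] (ract : a →ₗ[ℂ] A →ₗ[ℂ] a) (π : A →ₗ[ℂ] a)
    (hπ : ∀ y z, π (y * z) = ract (π y) z) (s : A ⊗[ℂ] A) :
    TensorProduct.assoc ℂ A a A
      (galoisMap (diagonalAct ract) (((TensorProduct.mk ℂ A a).flip (π 1)).rTensor A s)) =
      (leftCoaction π).lTensor A (galoisMap (LinearMap.mul ℂ A) s) := by
  induction s with
  | zero => simp
  | add n₁ n₂ h₁ h₂ => simp only [map_add, h₁, h₂]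
  | tmul p q =>
    have h : diagonalAct ract (p ⊗ₜ π 1) =
        TensorProduct.map (LinearMap.mul ℂ A p) π ∘ₗ Coalgebra.comul := by
      ext y
      have : ract (π 1) = π := by
        ext z
        simp [← hπ]
      simp [diagonalAct_tmul, this]
    have h₁ : (TensorProduct.assoc ℂ A a A).toLinearMap ∘ₗ
          (TensorProduct.map (LinearMap.mul ℂ A p) π).rTensor A =
        TensorProduct.map (LinearMap.mul ℂ A p) (π.rTensor A) ∘ₗ
          (TensorProduct.assoc ℂ A A A).toLinearMap := by
      ext
      simp
    have h₂ := LinearMap.congr_fun h₁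
      ((Coalgebra.comul (R := ℂ)).rTensor A (Coalgebra.comul (R := ℂ) q))
    have h₃ : (leftCoaction π).lTensor A ∘ₗ (LinearMap.mul ℂ A p).rTensor A =
        TensorProduct.map (LinearMap.mul ℂ A p) (π.rTensor A) ∘ₗ
          (Coalgebra.comul (R := ℂ)).lTensor A := by
      ext
      simp [leftCoaction]
    have h₄ := LinearMap.congr_fun h₃ (Coalgebra.comul (R := ℂ) q)
    simp only [LinearMap.comp_apply, LinearEquiv.coe_coe, Coalgebra.coassoc_apply] at h₂ h₄
    rw [LinearMap.rTensor_tmul, galoisMap_tmul, galoisMap_tmul, LinearMap.flip_apply,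
      TensorProduct.mk_apply, h, LinearMap.rTensor_comp_apply, h₂, h₄]

theorem counitEval_galoisMap [Bialgebra ℂ A] (s : A ⊗[ℂ] A) :
    counitEval A A (galoisMap (LinearMap.mul ℂ A) s) = counitEval A A s := by
  induction s with
  | zero => simp
  | add n₁ n₂ h₁ h₂ => simp only [map_add, h₁, h₂]
  | tmul p q =>
    have h : counitEval A A ∘ₗ (LinearMap.mul ℂ A p).rTensor A =
        Coalgebra.counit (R := ℂ) p •
          ((TensorProduct.lid ℂ A).toLinearMap ∘ₗ (Coalgebra.counit (R := ℂ)).rTensor A) := by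
      ext
      simp [counitEval, mul_smul]
    have := LinearMap.congr_fun h (Coalgebra.comul (R := ℂ) q)
    rw [LinearMap.comp_apply] at this
    rw [galoisMap_tmul, this]
    simp [counitEval]

theorem lTensor_counit_galoisMap [Bialgebra ℂ A] (s : A ⊗[ℂ] A) :
    (Coalgebra.counit (R := ℂ)).lTensor A (galoisMap (LinearMap.mul ℂ A) s) =
      LinearMap.mul' ℂ A s ⊗ₜ 1 := by
  induction s with
  | zero => simp
  | add n₁ n₂ h₁ h₂ => simp only [map_add, h₁, h₂, TensorProduct.add_tmul]
  | tmul p q =>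
    have h : (Coalgebra.counit (R := ℂ)).lTensor A ∘ₗ (LinearMap.mul ℂ A p).rTensor A =
        (LinearMap.mul ℂ A p).rTensor ℂ ∘ₗ (Coalgebra.counit (R := ℂ)).lTensor A := by
      ext
      simp
    have := LinearMap.congr_fun h (Coalgebra.comul (R := ℂ) q)
    rw [LinearMap.comp_apply] at this
    rw [galoisMap_tmul, this, LinearMap.comp_apply, Coalgebra.lTensor_counit_comul]
    simp

theorem isLeftComodule_leftCoaction [Bialgebra ℂ A] [Coalgebra ℂ a] (π : A →ₗc[ℂ] a) :
    IsLeftComodule a A (leftCoaction π.toLinearMap) := by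
  have hcomul : Coalgebra.comul ∘ₗ π.toLinearMap =
      TensorProduct.map π.toLinearMap π.toLinearMap ∘ₗ Coalgebra.comul := π.map_comp_comul.symm
  have hcounit : Coalgebra.counit ∘ₗ π.toLinearMap = Coalgebra.counit := π.counit_comp
  constructor
  · have h₁ : (TensorProduct.assoc ℂ a a A).toLinearMap ∘ₗ
          (TensorProduct.map π.toLinearMap π.toLinearMap).rTensor A =
        TensorProduct.map π.toLinearMap (π.toLinearMap.rTensor A) ∘ₗ
          (TensorProduct.assoc ℂ A A A).toLinearMap := by
      ext
      simp
    have h₂ : TensorProduct.map LinearMap.id (leftCoaction π.toLinearMap) ∘ₗ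
          π.toLinearMap.rTensor A =
        TensorProduct.map π.toLinearMap (π.toLinearMap.rTensor A) ∘ₗ
          (Coalgebra.comul (R := ℂ)).lTensor A := by
      ext
      simp [leftCoaction]
    have h₃ : TensorProduct.map Coalgebra.comul LinearMap.id ∘ₗ π.toLinearMap.rTensor A =
        (TensorProduct.map π.toLinearMap π.toLinearMap).rTensor A ∘ₗ
          (Coalgebra.comul (R := ℂ)).rTensor A := by
      rw [← LinearMap.rTensor_comp, ← hcomul, LinearMap.rTensor_comp]
      rfl
    ext y
    have e₁ := LinearMap.congr_fun h₁
      ((Coalgebra.comul (R := ℂ)).rTensor A (Coalgebra.comul (R := ℂ) y))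
    have e₂ := LinearMap.congr_fun h₂ (Coalgebra.comul (R := ℂ) y)
    have e₃ := LinearMap.congr_fun h₃ (Coalgebra.comul (R := ℂ) y)
    simp only [LinearMap.comp_apply, LinearEquiv.coe_coe, Coalgebra.coassoc_apply] at e₁ e₂ e₃
    simp only [LinearMap.comp_apply, LinearEquiv.coe_coe]
    conv_lhs => rw [leftCoaction, LinearMap.comp_apply, e₃, e₁]
    conv_rhs => rw [leftCoaction, LinearMap.comp_apply]
    exact e₂.symm
  · have h : TensorProduct.map Coalgebra.counit LinearMap.id ∘ₗ leftCoaction π.toLinearMap =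
        (Coalgebra.counit (R := ℂ)).rTensor A ∘ₗ Coalgebra.comul := by
      rw [← hcounit, LinearMap.rTensor_comp]
      rfl
    rw [h]
    ext y
    simp

/-- Restriction of a comodule structure along an injective map intertwining the coactions. -/
theorem IsLeftComodule.of_injective {C M K : Type} [AddCommGroup C] [Module ℂ C] [Coalgebra ℂ C]
    [AddCommGroup M] [Module ℂ M] [AddCommGroup K] [Module ℂ K]
    {ρ : M →ₗ[ℂ] C ⊗[ℂ] M} (hρ : IsLeftComodule C M ρ) (j : K →ₗ[ℂ] M)
    (hj : Function.Injective j) (ρK : K →ₗ[ℂ] C ⊗[ℂ] K)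
    (h : j.lTensor C ∘ₗ ρK = ρ ∘ₗ j) : IsLeftComodule C K ρK := by
  have hinj := Module.Flat.lTensor_preserves_injective_linearMap (M := C) j hj
  have hinj₂ := Module.Flat.lTensor_preserves_injective_linearMap (M := C) _ hinj
  have hk (k : K) : j.lTensor C (ρK k) = ρ (j k) := LinearMap.congr_fun h k
  constructor
  · ext k
    apply hinj₂
    have h₁ : (j.lTensor C).lTensor C ∘ₗ (TensorProduct.assoc ℂ C C K).toLinearMap ∘ₗ
          TensorProduct.map Coalgebra.comul LinearMap.id =
        (TensorProduct.assoc ℂ C C M).toLinearMap ∘ₗ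
          TensorProduct.map Coalgebra.comul LinearMap.id ∘ₗ j.lTensor C := by
      have : (j.lTensor C).lTensor C ∘ₗ (TensorProduct.assoc ℂ C C K).toLinearMap =
          (TensorProduct.assoc ℂ C C M).toLinearMap ∘ₗ j.lTensor (C ⊗[ℂ] C) := by
        ext
        simp
      rw [← LinearMap.comp_assoc, this]
      ext
      simp
    have h₂ : (j.lTensor C).lTensor C ∘ₗ TensorProduct.map LinearMap.id ρK =
        TensorProduct.map LinearMap.id ρ ∘ₗ j.lTensor C := by
      ext
      simp [hk]
    have e₁ := LinearMap.congr_fun h₁ (ρK k)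
    have e₂ := LinearMap.congr_fun h₂ (ρK k)
    have e₃ := LinearMap.congr_fun hρ.1 (j k)
    simp only [LinearMap.comp_apply, hk] at e₁ e₂ e₃ ⊢
    rw [e₁, e₂, e₃]
  · ext k
    apply hj
    have h₁ : j ∘ₗ (TensorProduct.lid ℂ K).toLinearMap ∘ₗ
          TensorProduct.map Coalgebra.counit LinearMap.id =
        (TensorProduct.lid ℂ M).toLinearMap ∘ₗ
          TensorProduct.map Coalgebra.counit LinearMap.id ∘ₗ j.lTensor C := by
      ext
      simp
    have e₁ := LinearMap.congr_fun h₁ (ρK k)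
    have e₃ := LinearMap.congr_fun hρ.2 (j k)
    simp only [LinearMap.comp_apply, hk] at e₁ e₃ ⊢
    rw [e₁, e₃]
    rfl

/-- A subspace whose image under a coaction on `M` lies in `C ⊗ K` inherits a coaction. -/
theorem exists_restrict_coaction {C M K : Type} [AddCommGroup C] [Module ℂ C]
    [AddCommGroup M] [Module ℂ M] [AddCommGroup K] [Module ℂ K]
    (ρ : M →ₗ[ℂ] C ⊗[ℂ] M) (j : K →ₗ[ℂ] M) (hj : Function.Injective j)
    (h : ∀ k, ρ (j k) ∈ LinearMap.range (j.lTensor C)) :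
    ∃ ρK : K →ₗ[ℂ] C ⊗[ℂ] K, j.lTensor C ∘ₗ ρK = ρ ∘ₗ j := by
  obtain ⟨p, hp⟩ := j.exists_leftInverse_of_injective (LinearMap.ker_eq_bot.mpr hj)
  refine ⟨p.lTensor C ∘ₗ ρ ∘ₗ j, ?_⟩
  ext k
  obtain ⟨z, hz⟩ := h k
  rw [LinearMap.comp_apply, LinearMap.comp_apply, LinearMap.comp_apply, ← hz,
    ← LinearMap.lTensor_comp_apply C p j, hp, LinearMap.lTensor_id, LinearMap.id_apply]

theorem leftCoaction_ker_mem_range [Bialgebra ℂ A] [Coalgebra ℂ a] (π : A →ₗc[ℂ] a)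
    (k : LinearMap.ker π.toLinearMap) :
    leftCoaction π.toLinearMap ((LinearMap.ker π.toLinearMap).subtype k) ∈
      LinearMap.range ((LinearMap.ker π.toLinearMap).subtype.lTensor a) := by
  refine (Module.Flat.lTensor_exact a
    (LinearMap.exact_subtype_ker_map π.toLinearMap) _).mp ?_
  have h : π.toLinearMap.lTensor a ∘ₗ leftCoaction π.toLinearMap =
      Coalgebra.comul ∘ₗ π.toLinearMap := by
    rw [leftCoaction, ← LinearMap.comp_assoc, LinearMap.lTensor_comp_rTensor]
    exact π.map_comp_comul
  have := LinearMap.congr_fun h k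
  simp only [LinearMap.comp_apply, LinearMap.mem_ker.mp k.2, map_zero] at this
  exact this

/-- An element of `A ⊗ A` whose image under the Galois map is cotensor lies in
`A^{co a} ⊗ A`. -/
theorem rTensor_rhoA_eq_of_galoisMap_mem_cotensor [HopfAlgebra ℂ A]
    (ract : a →ₗ[ℂ] A →ₗ[ℂ] a) (h_one : ∀ u, ract u 1 = u)
    (h_mul : ∀ u y z, ract u (y * z) = ract (ract u y) z) (π : A →ₗ[ℂ] a)
    (hπ : ∀ y z, π (y * z) = ract (π y) z) (s : A ⊗[ℂ] A)
    (hs : galoisMap (LinearMap.mul ℂ A) s ∈ cotensor A a A π (leftCoaction π)) :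
    (rhoA A a π).rTensor A s = ((TensorProduct.mk ℂ A a).flip (π 1)).rTensor A s := by
  apply (galoisMap_bijective (diagonalAct ract) (diagonalAct_one ract h_one)
    (diagonalAct_mul ract h_mul)).injective
  apply (TensorProduct.assoc ℂ A a A).injective
  rw [galoisMap_rTensor_mk_one ract π hπ, galoisMap_rTensor_rhoA ract π hπ]
  rw [cotensor, LinearMap.mem_ker, LinearMap.sub_apply, sub_eq_zero] at hs
  exact hs

theorem lTensor_mem_cotensor [Bialgebra ℂ A] {M K : Type}
    [AddCommGroup M] [Module ℂ M] [AddCommGroup K] [Module ℂ K] (π : A →ₗ[ℂ] a)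
    (ρ : M →ₗ[ℂ] a ⊗[ℂ] M) (ρK : K →ₗ[ℂ] a ⊗[ℂ] K) (j : K →ₗ[ℂ] M)
    (h : j.lTensor a ∘ₗ ρK = ρ ∘ₗ j) {w : A ⊗[ℂ] K} (hw : w ∈ cotensor A a K π ρK) :
    j.lTensor A w ∈ cotensor A a M π ρ := by
  rw [cotensor, LinearMap.mem_ker, LinearMap.sub_apply, sub_eq_zero] at hw ⊢
  have h₁ : ((TensorProduct.assoc ℂ A a M).toLinearMap ∘ₗ
        TensorProduct.map (rhoA A a π) LinearMap.id) ∘ₗ j.lTensor A =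
      (j.lTensor a).lTensor A ∘ₗ (TensorProduct.assoc ℂ A a K).toLinearMap ∘ₗ
        TensorProduct.map (rhoA A a π) LinearMap.id := by
    have : (j.lTensor a).lTensor A ∘ₗ (TensorProduct.assoc ℂ A a K).toLinearMap =
        (TensorProduct.assoc ℂ A a M).toLinearMap ∘ₗ j.lTensor (A ⊗[ℂ] a) := by
      ext
      simp
    rw [← LinearMap.comp_assoc _ _ ((j.lTensor a).lTensor A), this]
    ext
    simp
  have h₂ : TensorProduct.map LinearMap.id ρ ∘ₗ j.lTensor A =
      (j.lTensor a).lTensor A ∘ₗ TensorProduct.map LinearMap.id ρK := by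
    ext x k
    have := LinearMap.congr_fun h k
    simp only [LinearMap.comp_apply] at this
    simp [this]
  have e₁ := LinearMap.congr_fun h₁ w
  have e₂ := LinearMap.congr_fun h₂ w
  rw [LinearMap.comp_apply] at e₁ e₂
  rw [e₁, e₂]
  exact congrArg ((j.lTensor a).lTensor A) hw

end Coaction

/-- Let `(O, A, a)` be a triple satisfying conditions (i) and (ii), and
assume that for every left `a`-comodule `M` the map `(A ⊗ M)^a → M`,
`w ↦ (ε_A ⊗ id_M)(w)`, is surjective.  Then `ι(m)·A = ker(π)`, i.e. condition (iii)
holds. -/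
theorem statement8 (O A a : Type) [CommRing O] [Ring A]
    [HopfAlgebra ℂ O] [HopfAlgebra ℂ A]
    [AddCommGroup a] [Module ℂ a] [Coalgebra ℂ a]
    (ι : O →ₐc[ℂ] A) (hι : Function.Injective ι)
    (ract : a →ₗ[ℂ] A →ₗ[ℂ] a)
    (hract_one : ∀ u : a, ract u 1 = u)
    (hract_mul : ∀ (u : a) (y z : A), ract u (y * z) = ract (ract u y) z)
    (π : A →ₗc[ℂ] a)
    (hπ_surj : Function.Surjective π)
    (hπ_rmod : ∀ y z : A, π (y * z) = ract (π y) z)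
    (cond_i : ∀ o : O, π (ι o) = Coalgebra.counit (R := ℂ) o • π 1)
    (cond_ii : ∀ x : A, rhoA A a π.toLinearMap x = x ⊗ₜ[ℂ] π 1 ↔ x ∈ Set.range ι)
    (hsurj : ∀ (M : Type) [AddCommGroup M] [Module ℂ M]
      (ρM : M →ₗ[ℂ] a ⊗[ℂ] M), IsLeftComodule a M ρM →
        ∀ m : M, ∃ w ∈ cotensor A a M π.toLinearMap ρM, counitEval A M w = m) :
    Submodule.span ℂ {z : A | ∃ o : O, ∃ x : A,
        Coalgebra.counit (R := ℂ) o = 0 ∧ z = ι o * x} = LinearMap.ker π.toLinearMap := by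
  set J := Submodule.span ℂ {z : A | ∃ o : O, ∃ x : A,
        Coalgebra.counit (R := ℂ) o = 0 ∧ z = ι o * x} with hJ
  apply le_antisymm
  · rw [hJ, Submodule.span_le]
    rintro _ ⟨o, x, ho, rfl⟩
    have : π (ι o * x) = 0 := by rw [hπ_rmod, cond_i, ho]; simp
    exact this
  · intro k hk
    set K := LinearMap.ker π.toLinearMap
    obtain ⟨ρK, hρK⟩ := exists_restrict_coaction (leftCoaction π.toLinearMap) K.subtype
      K.injective_subtype (leftCoaction_ker_mem_range π)
    obtain ⟨w, hw, hwk⟩ := hsurj K ρK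
      ((isLeftComodule_leftCoaction π).of_injective K.subtype K.injective_subtype ρK hρK) ⟨k, hk⟩
    obtain ⟨s, hs⟩ := (galoisMap_bijective (LinearMap.mul ℂ A) (by simp)
      (by simp [mul_assoc])).surjective (K.subtype.lTensor A w)
    have hs_inv := rTensor_rhoA_eq_of_galoisMap_mem_cotensor ract hract_one hract_mul
      π.toLinearMap hπ_rmod s
      (by rw [hs]; exact lTensor_mem_cotensor π.toLinearMap _ _ K.subtype hρK hw)
    have hexact : Function.Exact (ι : O →ₐ[ℂ] A).toLinearMap
        (rhoA A a π.toLinearMap - (TensorProduct.mk ℂ A a).flip (π 1)) := by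
      intro x
      rw [LinearMap.sub_apply, sub_eq_zero]
      exact cond_ii x
    obtain ⟨t, rfl⟩ := (Module.Flat.rTensor_exact A hexact s).mp (by
      rw [LinearMap.rTensor_sub]
      exact sub_eq_zero.mpr hs_inv)
    have hmul : LinearMap.mul' ℂ A ((ι : O →ₐ[ℂ] A).toLinearMap.rTensor A t) = 0 := by
      have h₁ : (Coalgebra.counit (R := ℂ) (A := A)) ∘ₗ K.subtype = 0 := by
        ext y
        have : Coalgebra.counit (R := ℂ) (π y) = Coalgebra.counit (R := ℂ) (y : A) :=
          LinearMap.congr_fun π.counit_comp (y : A)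
        have hy : π (y : A) = 0 := y.2
        rw [hy, map_zero] at this
        exact this.symm
      have h₂ := lTensor_counit_galoisMap ((ι : O →ₐ[ℂ] A).toLinearMap.rTensor A t)
      rw [hs, ← LinearMap.lTensor_comp_apply, h₁, LinearMap.lTensor_zero,
        LinearMap.zero_apply] at h₂
      simpa using congrArg (TensorProduct.rid ℂ A) h₂.symm
    have heval : counitEval A A ((ι : O →ₐ[ℂ] A).toLinearMap.rTensor A t) = k := by
      have h₁ : counitEval A A ∘ₗ K.subtype.lTensor A = K.subtype ∘ₗ counitEval A K := by
        ext
        simp [counitEval]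
      have h₂ := LinearMap.congr_fun h₁ w
      rw [LinearMap.comp_apply, LinearMap.comp_apply, hwk] at h₂
      rw [← counitEval_galoisMap, hs, h₂]
      rfl
    rw [← heval, ← sub_zero (counitEval A A _), ← hmul]
    clear hs hs_inv hmul heval
    induction t with
    | zero => simp
    | add t₁ t₂ h₁ h₂ =>
      rw [map_add, map_add, map_add, add_sub_add_comm]
      exact J.add_mem h₁ h₂
    | tmul o z =>
      refine Submodule.subset_span
        ⟨algebraMap ℂ O (Coalgebra.counit (R := ℂ) o) - o, z, by simp, ?_⟩
      have : Coalgebra.counit (R := ℂ) (ι o) = Coalgebra.counit (R := ℂ) o := by simp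
      simp [counitEval, sub_mul, Algebra.algebraMap_eq_smul_one]
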